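/- arXiv:1812.11854 — 6 statements merged into one kernel-verified Lean document; each statement's English description precedes it below -/
import Mathlib

section
/- For all natural numbers n and m with n ≥ 2 and m ≥ 1, H(n+m) = h(n)·H(m+1) + (s·h(n−1) + t·h(n−2))·H(m) + t·h(n−1)·H(m−1). -/
theorem horadam_add {r s t : ℝ} {H h : ℕ → ℝ}
    (hHrec : ∀ n, H (n + 3) = r * H (n + 2) + s * H (n + 1) + t * H n)
    (hh0 : h 0 = 0) (hh1 : h 1 = 1) (hh2 : h 2 = r)
    (hhrec : ∀ n, h (n + 3) = r * h (n + 2) + s * h (n + 1) + t * h n) (k j : ℕ) :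
    H (k + j + 3) = h (k + 2) * H (j + 2) + (s * h (k + 1) + t * h k) * H (j + 1)
      + t * h (k + 1) * H j := by
  induction k generalizing j with
  | zero =>
    simp only [zero_add, hHrec, hh0, hh1, hh2]
    ring
  | succ k ih =>
    rw [Nat.add_right_comm k 1 j, Nat.add_assoc k j 1, ih (j + 1), hHrec j,
      show k + 1 + 2 = k + 3 from rfl, hhrec k]
    ring

theorem stmt_0 (r s t a b c : ℝ) (H h : ℕ → ℝ)
    (hH0 : H 0 = a) (hH1 : H 1 = b) (hH2 : H 2 = c)
    (hHrec : ∀ n, H (n + 3) = r * H (n + 2) + s * H (n + 1) + t * H n)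
    (hh0 : h 0 = 0) (hh1 : h 1 = 1) (hh2 : h 2 = r)
    (hhrec : ∀ n, h (n + 3) = r * h (n + 2) + s * h (n + 1) + t * h n)
    (n m : ℕ) (hn : 2 ≤ n) (hm : 1 ≤ m) :
    H (n + m) = h n * H (m + 1) + (s * h (n - 1) + t * h (n - 2)) * H m
      + t * h (n - 1) * H (m - 1) := by
  obtain ⟨k, rfl⟩ := Nat.exists_eq_add_of_le' hn
  obtain ⟨j, rfl⟩ := Nat.exists_eq_add_of_le' hm
  rw [show k + 2 + (j + 1) = k + j + 3 by omega]
  exact horadam_add hHrec hh0 hh1 hh2 hhrec k j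
end

section
/- For every natural number n ≥ 2, (h(n))² + s·(h(n−1))² + 2·t·h(n−1)·h(n−2) = h(2n−1). -/
/-- Addition formula for the generalized Tribonacci sequence. -/
theorem tribonacci_add {R : Type*} [CommRing R] (r s t : R) (h : ℕ → R)
    (hh0 : h 0 = 0) (hh1 : h 1 = 1) (hh2 : h 2 = r)
    (hhrec : ∀ n, h (n + 3) = r * h (n + 2) + s * h (n + 1) + t * h n) (m k : ℕ) :
    h (m + k + 3) =
      h (m + 2) * h (k + 2) + (s * h (k + 1) + t * h k) * h (m + 1) + t * h (k + 1) * h m := by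
  induction k generalizing m with
  | zero =>
    simp only [add_zero, zero_add, hh0, hh1, hh2, hhrec]
    ring
  | succ k ih =>
    rw [show m + (k + 1) + 3 = m + 1 + k + 3 by ring, ih (m + 1)]
    simp only [add_assoc, Nat.reduceAdd, hhrec]
    ring

theorem stmt_1 (r s t : ℝ) (h : ℕ → ℝ)
    (hh0 : h 0 = 0) (hh1 : h 1 = 1) (hh2 : h 2 = r)
    (hhrec : ∀ n, h (n + 3) = r * h (n + 2) + s * h (n + 1) + t * h n)
    (n : ℕ) (hn : 2 ≤ n) :
    (h n) ^ 2 + s * (h (n - 1)) ^ 2 + 2 * t * h (n - 1) * h (n - 2) = h (2 * n - 1) := by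
  obtain ⟨k, rfl⟩ := Nat.exists_eq_add_of_le' hn
  rw [show 2 * (k + 2) - 1 = k + k + 3 by lia, show k + 2 - 1 = k + 1 by lia,
    Nat.add_sub_cancel, tribonacci_add r s t h hh0 hh1 hh2 hhrec]
  ring
end

section
/- For every natural number n ≥ 2, (H(n))² + s·(H(n−1))² + 2·t·H(n−1)·H(n−2) = c·H(2n−2) + (s·b + t·a)·H(2n−3) + t·b·H(2n−4). -/
/-- The symmetric bilinear form attached to a third-order linear recurrence depends only on the
sum of the two indices. -/
theorem thirdOrder_bilinear_eq (r s t : ℝ) (H : ℕ → ℝ)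
    (hHrec : ∀ n, H (n + 3) = r * H (n + 2) + s * H (n + 1) + t * H n) (m k : ℕ) :
    H (m + 2) * H (k + 2) + s * H (m + 1) * H (k + 1) + t * (H (m + 1) * H k + H m * H (k + 1))
      = H (m + k + 2) * H 2 + s * H (m + k + 1) * H 1
        + t * (H (m + k + 1) * H 0 + H (m + k) * H 1) := by
  induction k generalizing m with
  | zero => simp
  | succ k ih =>
    have h := ih (m + 1)
    rw [show m + 1 + k = m + (k + 1) by ring] at h
    rw [← h, show k + 1 + 2 = k + 3 by ring, show m + 1 + 2 = m + 3 by ring, hHrec k, hHrec m]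
    ring

theorem stmt_2 (r s t a b c : ℝ) (H : ℕ → ℝ)
    (hH0 : H 0 = a) (hH1 : H 1 = b) (hH2 : H 2 = c)
    (hHrec : ∀ n, H (n + 3) = r * H (n + 2) + s * H (n + 1) + t * H n)
    (n : ℕ) (hn : 2 ≤ n) :
    (H n) ^ 2 + s * (H (n - 1)) ^ 2 + 2 * t * H (n - 1) * H (n - 2)
      = c * H (2 * n - 2) + (s * b + t * a) * H (2 * n - 3) + t * b * H (2 * n - 4) := by
  obtain ⟨m, rfl⟩ := Nat.exists_eq_add_of_le' hn
  have h := thirdOrder_bilinear_eq r s t H hHrec m m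
  rw [hH0, hH1, hH2] at h
  rw [show m + 2 - 1 = m + 1 by lia, show m + 2 - 2 = m by lia,
    show 2 * (m + 2) - 2 = m + m + 2 by lia, show 2 * (m + 2) - 3 = m + m + 1 by lia,
    show 2 * (m + 2) - 4 = m + m by lia]
  linear_combination h
end

section
/- Suppose α, ω₁, ω₂ are pairwise distinct complex numbers each satisfying x³ = r·x² + s·x + t. Then for every natural number n, M_H(n) = ((α−ω₁)·(α−ω₂))⁻¹·αⁿ·(M_H(2) − (ω₁+ω₂)·M_H(1) + ω₁·ω₂·M_H(0)) − ((α−ω₁)·(ω₁−ω₂))⁻¹·ω₁ⁿ·(M_H(2) − (α+ω₂)·M_H(1) + α·ω₂·M_H(0)) + ((α−ω₂)·(ω₁−ω₂))⁻¹·ω₂ⁿ·(M_H(2) − (α+ω₁)·M_H(1) + α·ω₁·M_H(0)). -/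
/-- Binet's formula for a sequence in a vector space satisfying a third-order linear recurrence
whose characteristic polynomial has three distinct roots `x`, `y`, `z`. -/
theorem binet_of_third_order_recurrence {K V : Type*} [Field K] [AddCommGroup V] [Module K V]
    {r s t x y z : K} {u : ℕ → V}
    (hu : ∀ n, u (n + 3) = r • u (n + 2) + s • u (n + 1) + t • u n)
    (hxy : x ≠ y) (hxz : x ≠ z) (hyz : y ≠ z)
    (hx : x ^ 3 = r * x ^ 2 + s * x + t)
    (hy : y ^ 3 = r * y ^ 2 + s * y + t)
    (hz : z ^ 3 = r * z ^ 2 + s * z + t) (n : ℕ) :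
    u n = (((x - y) * (x - z))⁻¹ * x ^ n) • (u 2 - (y + z) • u 1 + (y * z) • u 0)
        - (((x - y) * (y - z))⁻¹ * y ^ n) • (u 2 - (x + z) • u 1 + (x * z) • u 0)
        + (((x - z) * (y - z))⁻¹ * z ^ n) • (u 2 - (x + y) • u 1 + (x * y) • u 0) := by
  have hxy' := sub_ne_zero.mpr hxy
  have hxz' := sub_ne_zero.mpr hxz
  have hyz' := sub_ne_zero.mpr hyz
  induction n using Nat.strong_induction_on with
  | _ n ih =>
    match n with
    | 0 | 1 | 2 => match_scalars <;> field_simp <;> ring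
    | n + 3 =>
      rw [hu, ih (n + 2) (by lia), ih (n + 1) (by lia), ih n (by lia),
        pow_add x n 3, pow_add y n 3, pow_add z n 3, hx, hy, hz]
      module


theorem stmt_4 (r s t a b c : ℂ) (ht : t ≠ 0)
    (M : ℕ → Matrix (Fin 3) (Fin 3) ℂ)
    (hM0 : M 0 = !![b, c - r * b, t * a;
                    a, b - r * a, c - r * b - s * a;
                    (c - r * b - s * a) / t, r * (-c + r * b + s * a) / t,
                      (-(s * c) + (t + r * s) * b + (s ^ 2 - r * t) * a) / t])
    (hM1 : M 1 = !![c, s * b + t * a, t * b;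
                    b, c - r * b, t * a;
                    a, b - r * a, c - r * b - s * a])
    (hM2 : M 2 = !![r * c + s * b + t * a, s * c + t * b, t * c;
                    c, s * b + t * a, t * b;
                    b, c - r * b, t * a])
    (hMrec : ∀ n, M (n + 3) = r • M (n + 2) + s • M (n + 1) + t • M n)
    (α ω₁ ω₂ : ℂ)
    (hαω₁ : α ≠ ω₁) (hαω₂ : α ≠ ω₂) (hω₁ω₂ : ω₁ ≠ ω₂)
    (hα : α ^ 3 = r * α ^ 2 + s * α + t)
    (hω₁ : ω₁ ^ 3 = r * ω₁ ^ 2 + s * ω₁ + t)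
    (hω₂ : ω₂ ^ 3 = r * ω₂ ^ 2 + s * ω₂ + t)
    (n : ℕ) :
    M n = (((α - ω₁) * (α - ω₂))⁻¹ * α ^ n) • (M 2 - (ω₁ + ω₂) • M 1 + (ω₁ * ω₂) • M 0)
        - (((α - ω₁) * (ω₁ - ω₂))⁻¹ * ω₁ ^ n) • (M 2 - (α + ω₂) • M 1 + (α * ω₂) • M 0)
        + (((α - ω₂) * (ω₁ - ω₂))⁻¹ * ω₂ ^ n) • (M 2 - (α + ω₁) • M 1 + (α * ω₁) • M 0) := by
  exact binet_of_third_order_recurrence hMrec hαω₁ hαω₂ hω₁ω₂ hα hω₁ hω₂ n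
end

section
/- For every natural number n ≥ 3, M_h(n) equals the 3×3 matrix [[h(n+1), s·h(n)+t·h(n−1), t·h(n)],[h(n), s·h(n−1)+t·h(n−2), t·h(n−1)],[h(n−1), s·h(n−2)+t·h(n−3), t·h(n−2)]]. -/
/-- Two sequences satisfying the same third-order linear recurrence and sharing their first three
terms are equal. -/
theorem eq_of_third_order_recurrence {R V : Type*} [Add V] [SMul R V] {r s t : R} {u v : ℕ → V}
    (hu : ∀ n, u (n + 3) = r • u (n + 2) + s • u (n + 1) + t • u n)
    (hv : ∀ n, v (n + 3) = r • v (n + 2) + s • v (n + 1) + t • v n)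
    (h0 : u 0 = v 0) (h1 : u 1 = v 1) (h2 : u 2 = v 2) : ∀ n, u n = v n
  | 0 => h0
  | 1 => h1
  | 2 => h2
  | n + 3 => by
    rw [hu, hv, eq_of_third_order_recurrence hu hv h0 h1 h2 (n + 2),
      eq_of_third_order_recurrence hu hv h0 h1 h2 (n + 1),
      eq_of_third_order_recurrence hu hv h0 h1 h2 n]

theorem stmt_7 (r s t : ℝ)
    (h : ℕ → ℝ)
    (hh0 : h 0 = 0) (hh1 : h 1 = 1) (hh2 : h 2 = r)
    (hhrec : ∀ n, h (n + 3) = r * h (n + 2) + s * h (n + 1) + t * h n)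
    (M : ℕ → Matrix (Fin 3) (Fin 3) ℝ)
    (hM0 : M 0 = 1)
    (hM1 : M 1 = !![r, s, t; 1, 0, 0; 0, 1, 0])
    (hM2 : M 2 = !![r ^ 2 + s, r * s + t, r * t; r, s, t; 1, 0, 0])
    (hMrec : ∀ n, M (n + 3) = r • M (n + 2) + s • M (n + 1) + t • M n)
    (n : ℕ) (hn : 3 ≤ n) :
    M n = !![h (n + 1), s * h n + t * h (n - 1), t * h n;
             h n, s * h (n - 1) + t * h (n - 2), t * h (n - 1);
             h (n - 1), s * h (n - 2) + t * h (n - 3), t * h (n - 2)] := by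
  obtain ⟨k, rfl⟩ := Nat.exists_eq_add_of_le' hn
  have h3 := hhrec 0
  have h4 := hhrec 1
  have h5 := hhrec 2
  have h6 := hhrec 3
  have M3 := hMrec 0
  have M4 := hMrec 1
  have M5 := hMrec 2
  norm_num only [hh0, hh1, hh2, hM0, hM1, hM2] at h3 h4 h5 h6 M3 M4 M5
  refine eq_of_third_order_recurrence (r := r) (s := s) (t := t) (u := fun k ↦ M (k + 3))
    (v := fun k ↦ !![h (k + 4), s * h (k + 3) + t * h (k + 2), t * h (k + 3);
                     h (k + 3), s * h (k + 2) + t * h (k + 1), t * h (k + 2);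
                     h (k + 2), s * h (k + 1) + t * h k, t * h (k + 1)])
    (fun k ↦ hMrec (k + 3)) (fun k ↦ ?_) ?_ ?_ ?_ k
  · ext i j
    fin_cases i <;> fin_cases j <;>
      simp [hhrec k, hhrec (k + 1), hhrec (k + 2), hhrec (k + 3), hhrec (k + 4)] <;> ring
  all_goals
    ext i j
    fin_cases i <;> fin_cases j <;>
      simp [M3, M4, M5, h3, h4, h5, h6, hh0, hh1, hh2, -mul_eq_mul_left_iff] <;> ring
end

section
/- For all natural numbers m and n, M_h(n)·M_h(m) = M_h(m)·M_h(n) = M_h(n+m). -/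
/-- The companion matrix of `x³ - r x² - s x - t`. -/
def tribonacciMatrix {R : Type*} [CommRing R] (r s t : R) : Matrix (Fin 3) (Fin 3) R :=
  !![r, s, t; 1, 0, 0; 0, 1, 0]

theorem tribonacciMatrix_sq {R : Type*} [CommRing R] (r s t : R) :
    tribonacciMatrix r s t ^ 2 = !![r ^ 2 + s, r * s + t, r * t; r, s, t; 1, 0, 0] := by
  ext i j
  fin_cases i <;> fin_cases j <;>
    simp [tribonacciMatrix, pow_two, Matrix.mul_apply, Fin.sum_univ_three]

theorem tribonacciMatrix_pow_three {R : Type*} [CommRing R] (r s t : R) :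
    tribonacciMatrix r s t ^ 3 =
      r • tribonacciMatrix r s t ^ 2 + s • tribonacciMatrix r s t + t • 1 := by
  rw [pow_succ, tribonacciMatrix_sq]
  ext i j
  fin_cases i <;> fin_cases j <;>
    simp [tribonacciMatrix, Matrix.mul_apply, Fin.sum_univ_three] <;> ring

/-- A sequence satisfying a third-order linear recurrence whose first three terms are powers of a
root `a` of the characteristic polynomial is the sequence of powers of `a`. -/
theorem eq_pow_of_third_order_recurrence {R A : Type*} [CommSemiring R] [Semiring A] [Algebra R A]
    {r s t : R} {a : A} (ha : a ^ 3 = r • a ^ 2 + s • a + t • 1) {u : ℕ → A}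
    (h0 : u 0 = 1) (h1 : u 1 = a) (h2 : u 2 = a ^ 2)
    (hrec : ∀ n, u (n + 3) = r • u (n + 2) + s • u (n + 1) + t • u n) (n : ℕ) :
    u n = a ^ n := by
  induction n using Nat.strong_induction_on with
  | _ n ih =>
    match n with
    | 0 => simp [h0]
    | 1 => simp [h1]
    | 2 => exact h2
    | n + 3 =>
      rw [hrec, ih n (by lia), ih (n + 1) (by lia), ih (n + 2) (by lia), pow_add a n 3, ha]
      simp [mul_add, pow_add]

theorem stmt_12 (r s t : ℝ)
    (M : ℕ → Matrix (Fin 3) (Fin 3) ℝ)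
    (hM0 : M 0 = 1)
    (hM1 : M 1 = !![r, s, t; 1, 0, 0; 0, 1, 0])
    (hM2 : M 2 = !![r ^ 2 + s, r * s + t, r * t; r, s, t; 1, 0, 0])
    (hMrec : ∀ n, M (n + 3) = r • M (n + 2) + s • M (n + 1) + t • M n)
    (m n : ℕ) :
    M n * M m = M m * M n ∧ M m * M n = M (n + m) := by
  have hpow : ∀ k, M k = tribonacciMatrix r s t ^ k :=
    eq_pow_of_third_order_recurrence (tribonacciMatrix_pow_three r s t) hM0 hM1
      (hM2.trans (tribonacciMatrix_sq r s t).symm) hMrec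
  simp only [hpow]
  exact ⟨by rw [← pow_add, ← pow_add, add_comm], by rw [← pow_add, add_comm]⟩
end
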